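/- arXiv:1904.02635 — 5 statements merged into one kernel-verified Lean document; each statement's English description precedes it below -/
import Mathlib

section
/- Let n ≥ 1, s ∈ (0,1), and let Ω ⊆ ℝⁿ be a non-empty bounded open set. Let u : ℝⁿ → ℝ be measurable with ∫_Ω u² dx < ∞ and ∬_{ℝ^{2n} ∖ (Ωᶜ×Ωᶜ)} |u(x)−u(y)|²/|x−y|^{n+2s} dx dy < ∞. Then ∫_{ℝⁿ} u(x)²/(1+|x|^{n+2s}) dx < ∞, and consequently ∫_{ℝⁿ} |u(x)|/(1+|x|^{n+2s}) dx < ∞. -/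
open MeasureTheory Filter Set

noncomputable section

/-- Euclidean space ℝⁿ. -/
abbrev En (n : ℕ) : Type := EuclideanSpace ℝ (Fin n)

/-- The annulus `A_{R₀,R} = {x : R₀ < |x| < R}`, understood as the ball `B_R` when `R₀ = 0`. -/
def annR (n : ℕ) (R₀ R : ℝ) : Set (En n) :=
  if R₀ = 0 then Metric.ball (0 : En n) R else {x : En n | R₀ < ‖x‖ ∧ ‖x‖ < R}

/-- The region `ℝ^{2n} ∖ (Ωᶜ × Ωᶜ)`: pairs (x,y) not both outside Ω. -/
def crossSet {n : ℕ} (Ω : Set (En n)) : Set (En n × En n) :=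
  {p : En n × En n | p.1 ∈ Ω ∨ p.2 ∈ Ω}

/-- Gagliardo integrand `|u(x) - u(y)|² / |x-y|^{n+2s}`. -/
def gagSq {n : ℕ} (s : ℝ) (u : En n → ℝ) (p : En n × En n) : ℝ :=
  |u p.1 - u p.2| ^ 2 / dist p.1 p.2 ^ ((n : ℝ) + 2 * s)

/-- Bilinear Gagliardo integrand `(u(x)-u(y))(v(x)-v(y)) / |x-y|^{n+2s}`. -/
def gagBil {n : ℕ} (s : ℝ) (u v : En n → ℝ) (p : En n × En n) : ℝ :=
  (u p.1 - u p.2) * (v p.1 - v p.2) / dist p.1 p.2 ^ ((n : ℝ) + 2 * s)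

/-- Membership in `H^s_{Ω,0}`. -/
def MemHs {n : ℕ} (s : ℝ) (Ω : Set (En n)) (u : En n → ℝ) : Prop :=
  Measurable u ∧ IntegrableOn (fun x => (u x) ^ 2) Ω ∧
    IntegrableOn (gagSq s u) (crossSet Ω)

/-- Square of the seminorm `[u]_{H^s_{Ω,0}}²`. -/
def seminormSq {n : ℕ} (c s : ℝ) (Ω : Set (En n)) (u : En n → ℝ) : ℝ :=
  (c / 2) * ∫ p in crossSet Ω, gagSq s u p

/-- The norm `‖u‖_{H^s_{Ω,0}} = ‖u‖_{L²(Ω)} + [u]_{H^s_{Ω,0}}`. -/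
def HsNorm {n : ℕ} (c s : ℝ) (Ω : Set (En n)) (u : En n → ℝ) : ℝ :=
  (∫ x in Ω, (u x) ^ 2) ^ (1/2 : ℝ) + (seminormSq c s Ω u) ^ (1/2 : ℝ)

/-- `u ∈ H^s_{Ω,0}` is a weak solution of the linear Neumann problem
`(-Δ)ˢ u + u = h` in Ω, `𝒩ₛ u = 0` outside. -/
def SolvesLin {n : ℕ} (c s : ℝ) (Ω : Set (En n)) (h u : En n → ℝ) : Prop :=
  MemHs s Ω u ∧ ∀ v : En n → ℝ, MemHs s Ω v →
    IntegrableOn (gagBil s u v) (crossSet Ω) ∧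
    IntegrableOn (fun x => u x * v x) Ω ∧
    IntegrableOn (fun x => h x * v x) Ω ∧
    (c / 2) * (∫ p in crossSet Ω, gagBil s u v p) + ∫ x in Ω, u x * v x
      = ∫ x in Ω, h x * v x

/-- Weak solution of the nonlinear Neumann problem `(-Δ)ˢ u + u = g(u)`, `u ≥ 0`. -/
def IsWeakSolution {n : ℕ} (c s : ℝ) (Ω : Set (En n)) (g : ℝ → ℝ) (u : En n → ℝ) : Prop :=
  (∀ᵐ x ∂(volume.restrict Ω), 0 ≤ u x) ∧ SolvesLin c s Ω (fun x => g (u x)) u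

/-- `u` is radial with profile `φ`. -/
def IsRadialWith {n : ℕ} (u : En n → ℝ) (φ : ℝ → ℝ) : Prop :=
  ∀ x : En n, u x = φ ‖x‖

/-- The cone `𝒞₊` of non-negative, radial, radially non-decreasing functions in `H^s_{Ω,0}`. -/
def InConePlus {n : ℕ} (s R₀ R : ℝ) (Ω : Set (En n)) (u : En n → ℝ) : Prop :=
  MemHs s Ω u ∧ (∀ x, 0 ≤ u x) ∧
    ∃ φ : ℝ → ℝ, IsRadialWith u φ ∧ MonotoneOn φ (Icc R₀ R)

/-- The cone `𝒞₋` of non-negative, radial, radially non-increasing functions in `H^s_{Ω,0}`. -/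
def InConeMinus {n : ℕ} (s R₀ R : ℝ) (Ω : Set (En n)) (u : En n → ℝ) : Prop :=
  MemHs s Ω u ∧ (∀ x, 0 ≤ u x) ∧
    ∃ φ : ℝ → ℝ, IsRadialWith u φ ∧ AntitoneOn φ (Icc R₀ R)

/-- The second radial increasing eigenvalue `λ₂^{+,r}(Ω)`. -/
def lambda2plusr {n : ℕ} (c s R₀ R : ℝ) (Ω : Set (En n)) : ℝ :=
  sInf { t : ℝ | ∃ (v : En n → ℝ) (φ : ℝ → ℝ), MemHs s Ω v ∧ IsRadialWith v φ ∧
    MonotoneOn φ (Icc R₀ R) ∧ (∫ x in Ω, v x) = 0 ∧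
    ¬ (∀ᵐ x ∂(volume.restrict Ω), v x = 0) ∧
    t = seminormSq c s Ω v / ∫ x in Ω, (v x) ^ 2 }

/-- The second radial eigenvalue `λ₂^{rad}(Ω)`. -/
def lambda2rad {n : ℕ} (c s : ℝ) (Ω : Set (En n)) : ℝ :=
  sInf { t : ℝ | ∃ (v : En n → ℝ) (φ : ℝ → ℝ), MemHs s Ω v ∧ IsRadialWith v φ ∧
    (∫ x in Ω, v x) = 0 ∧ ¬ (∀ᵐ x ∂(volume.restrict Ω), v x = 0) ∧
    t = seminormSq c s Ω v / ∫ x in Ω, (v x) ^ 2 }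

/-- The energy functional associated with the truncated problem, with `F̃(t) = ∫₀ᵗ f̃`. -/
def energy {n : ℕ} (c s : ℝ) (Ω : Set (En n)) (ftil : ℝ → ℝ) (u : En n → ℝ) : ℝ :=
  (c / 4) * (∫ p in crossSet Ω, gagSq s u p) + (1/2) * (∫ x in Ω, (u x) ^ 2)
    - ∫ x in Ω, (∫ τ in (0:ℝ)..(u x), ftil τ)

/-- The derivative of the energy functional: `E'(u)[v]`. -/
def Eprime {n : ℕ} (c s : ℝ) (Ω : Set (En n)) (ftil : ℝ → ℝ) (u v : En n → ℝ) : ℝ :=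
  (c / 2) * (∫ p in crossSet Ω, gagBil s u v p) + (∫ x in Ω, u x * v x)
    - ∫ x in Ω, ftil (u x) * v x


theorem add_rpow_le_two_rpow_mul {a b p : ℝ} (ha : 0 ≤ a) (hb : 0 ≤ b) (hp : 0 ≤ p) :
    (a + b) ^ p ≤ 2 ^ p * (1 + a ^ p) * (1 + b ^ p) := by
  have hap : 0 ≤ a ^ p := Real.rpow_nonneg ha p
  have hbp : 0 ≤ b ^ p := Real.rpow_nonneg hb p
  have hm : (max a b) ^ p ≤ (1 + a ^ p) * (1 + b ^ p) := by
    rcases max_cases a b with h | h <;> rw [h.1] <;> nlinarith [mul_nonneg hap hbp]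
  calc (a + b) ^ p ≤ (2 * max a b) ^ p := by
        apply Real.rpow_le_rpow (add_nonneg ha hb) _ hp
        linarith [le_max_left a b, le_max_right a b]
    _ = 2 ^ p * (max a b) ^ p := Real.mul_rpow zero_le_two (le_max_of_le_left ha)
    _ ≤ 2 ^ p * ((1 + a ^ p) * (1 + b ^ p)) := by gcongr
    _ = _ := by ring

theorem integrable_inv_one_add_norm_rpow {n : ℕ} {p : ℝ} (hp : (n : ℝ) < p) :
    Integrable (fun y : En n => 1 / (1 + ‖y‖ ^ p)) := by
  have hp0 : 0 ≤ p := (Nat.cast_nonneg n).trans hp.le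
  have h : Integrable (fun y : En n => (1 + ‖y‖) ^ (-p)) :=
    integrable_one_add_norm (by simpa using hp)
  refine (h.const_mul (2 ^ p * (1 + 1 ^ p))).mono'
    (Measurable.aestronglyMeasurable (by fun_prop)) (ae_of_all _ fun y => ?_)
  have hy : 0 ≤ ‖y‖ ^ p := Real.rpow_nonneg (norm_nonneg y) p
  have hy' : 0 < (1 + ‖y‖) ^ p := Real.rpow_pos_of_pos (by positivity) p
  rw [Real.norm_of_nonneg (by positivity), Real.rpow_neg (by positivity), ← div_eq_mul_inv,
    div_le_div_iff₀ (by positivity) hy', one_mul]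
  exact add_rpow_le_two_rpow_mul zero_le_one (norm_nonneg y) hp0

theorem exists_integrable_gagSq {n : ℕ} {s : ℝ} {Ω : Set (En n)} (hne : Ω.Nonempty)
    (hopen : IsOpen Ω) {u : En n → ℝ} (hgag : IntegrableOn (gagSq s u) (crossSet Ω)) :
    ∃ x : En n, Integrable (fun y => gagSq s u (x, y)) := by
  have h1 : IntegrableOn (gagSq s u) (Ω ×ˢ univ) := hgag.mono_set fun p hp => Or.inl hp.1
  have h2 : Integrable (gagSq s u) ((volume.restrict Ω).prod volume) := by
    rwa [IntegrableOn, Measure.volume_eq_prod, ← Measure.prod_restrict,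
      Measure.restrict_univ] at h1
  have : (ae (volume.restrict Ω)).NeBot :=
    ae_restrict_neBot.2 (hopen.measure_pos volume hne).ne'
  exact h2.prod_right_ae.exists

theorem sq_div_le_gagSq {n : ℕ} {s : ℝ} (hp : 0 ≤ (n : ℝ) + 2 * s) (u : En n → ℝ) (x y : En n) :
    (u x - u y) ^ 2 / (1 + ‖y‖ ^ ((n : ℝ) + 2 * s)) ≤
      2 ^ ((n : ℝ) + 2 * s) * (1 + ‖x‖ ^ ((n : ℝ) + 2 * s)) * gagSq s u (x, y) := by
  rcases eq_or_ne x y with rfl | hxy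
  · simp [gagSq]
  have hd : 0 < dist x y ^ ((n : ℝ) + 2 * s) := Real.rpow_pos_of_pos (dist_pos.2 hxy) _
  have hle : dist x y ^ ((n : ℝ) + 2 * s) ≤ 2 ^ ((n : ℝ) + 2 * s) *
      (1 + ‖x‖ ^ ((n : ℝ) + 2 * s)) * (1 + ‖y‖ ^ ((n : ℝ) + 2 * s)) :=
    (Real.rpow_le_rpow dist_nonneg (dist_le_norm_add_norm x y) hp).trans
      (add_rpow_le_two_rpow_mul (norm_nonneg x) (norm_nonneg y) hp)
  have hy : 0 ≤ ‖y‖ ^ ((n : ℝ) + 2 * s) := Real.rpow_nonneg (norm_nonneg y) _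
  simp only [gagSq, sq_abs]
  rw [← mul_div_assoc, div_le_div_iff₀ (by positivity) hd]
  calc _ ≤ (u x - u y) ^ 2 * _ := mul_le_mul_of_nonneg_left hle (sq_nonneg _)
    _ = _ := by ring

/-- functions in `H^s_{Ω,0}` satisfy the weighted integrability conditions. -/
theorem statement3 {n : ℕ} (hn : 1 ≤ n) {s : ℝ} (hs : s ∈ Ioo (0:ℝ) 1)
    {Ω : Set (En n)} (hne : Ω.Nonempty) (hopen : IsOpen Ω)
    (hbdd : Bornology.IsBounded Ω)
    (u : En n → ℝ) (hmeas : Measurable u)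
    (hL2 : IntegrableOn (fun x => (u x) ^ 2) Ω)
    (hgag : IntegrableOn (gagSq s u) (crossSet Ω)) :
    Integrable (fun x : En n => (u x) ^ 2 / (1 + ‖x‖ ^ ((n:ℝ) + 2 * s))) ∧
    Integrable (fun x : En n => |u x| / (1 + ‖x‖ ^ ((n:ℝ) + 2 * s))) := by
  have hp : (n : ℝ) < (n : ℝ) + 2 * s := by linarith [hs.1]
  have hp0 : 0 ≤ (n : ℝ) + 2 * s := (Nat.cast_nonneg n).trans hp.le
  have hw := integrable_inv_one_add_norm_rpow hp
  have hsq : Integrable (fun x : En n => (u x) ^ 2 / (1 + ‖x‖ ^ ((n:ℝ) + 2 * s))) := by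
    obtain ⟨x, hx⟩ := exists_integrable_gagSq hne hopen hgag
    refine ((hw.const_mul (2 * u x ^ 2)).add (hx.const_mul
      (2 * (2 ^ ((n : ℝ) + 2 * s) * (1 + ‖x‖ ^ ((n : ℝ) + 2 * s)))))).mono'
      (Measurable.aestronglyMeasurable (by fun_prop)) (ae_of_all _ fun y => ?_)
    have hy : 0 ≤ ‖y‖ ^ ((n : ℝ) + 2 * s) := Real.rpow_nonneg (norm_nonneg y) _
    rw [Real.norm_of_nonneg (by positivity)]
    calc u y ^ 2 / (1 + ‖y‖ ^ ((n : ℝ) + 2 * s))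
        ≤ (2 * u x ^ 2 + 2 * (u x - u y) ^ 2) / (1 + ‖y‖ ^ ((n : ℝ) + 2 * s)) := by
          gcongr
          nlinarith [sq_nonneg (2 * u x - u y)]
      _ = 2 * u x ^ 2 * (1 / (1 + ‖y‖ ^ ((n : ℝ) + 2 * s))) +
          2 * ((u x - u y) ^ 2 / (1 + ‖y‖ ^ ((n : ℝ) + 2 * s))) := by ring
      _ ≤ _ := by
          have := sq_div_le_gagSq hp0 u x y
          simp only [Pi.add_apply]
          linarith
  refine ⟨hsq, (hw.add hsq).mono' (Measurable.aestronglyMeasurable (by fun_prop))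
    (ae_of_all _ fun y => ?_)⟩
  have hy : 0 ≤ ‖y‖ ^ ((n : ℝ) + 2 * s) := Real.rpow_nonneg (norm_nonneg y) _
  rw [Real.norm_of_nonneg (by positivity), Pi.add_apply, ← add_div]
  gcongr
  nlinarith [sq_nonneg (|u y| - 1), sq_abs (u y), abs_nonneg (u y)]

end
end

section
/- Let n ≥ 1, s ∈ (1/2,1), 0 ≤ R₀ < R, and let Ω = A_{R₀,R} = {x ∈ ℝⁿ : R₀ < |x| < R} (a ball when R₀ = 0). Then there exists a constant C = C(R,R₀,n,s) > 0 such that ess sup_Ω |u| ≤ C ‖u‖_{H^s_{Ω,0}} for every u in the cone 𝒞₊(Ω) and, when R₀ > 0, also for every u in the cone 𝒞₋(A_{R₀,R}). -/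
open MeasureTheory Filter Set

noncomputable section

/-- The open shell `{x : a < |x| < b}`. -/
def shell (n : ℕ) (a b : ℝ) : Set (En n) := {x | a < ‖x‖ ∧ ‖x‖ < b}

lemma isOpen_shell (n : ℕ) (a b : ℝ) : IsOpen (shell n a b) :=
  (isOpen_lt continuous_const continuous_norm).inter (isOpen_lt continuous_norm continuous_const)

lemma shell_subset_ball (n : ℕ) (a b : ℝ) : shell n a b ⊆ Metric.ball 0 b := fun _ hx => by
  simpa using hx.2

lemma volume_shell_ne_top (n : ℕ) (a b : ℝ) : volume (shell n a b) ≠ ⊤ :=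
  ((measure_mono (shell_subset_ball n a b)).trans_lt measure_ball_lt_top).ne

lemma shell_subset_annR {n : ℕ} {R₀ R a b : ℝ} (ha : R₀ ≤ a) (hb : b ≤ R) :
    shell n a b ⊆ annR n R₀ R := by
  intro x hx
  unfold annR
  split_ifs
  · simpa using hx.2.trans_le hb
  · exact ⟨ha.trans_lt hx.1, hx.2.trans_le hb⟩

lemma norm_mem_of_mem_annR {n : ℕ} {R₀ R : ℝ} {x : En n} (hx : x ∈ annR n R₀ R) :
    R₀ ≤ ‖x‖ ∧ ‖x‖ < R := by
  unfold annR at hx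
  split_ifs at hx with h
  · exact ⟨h ▸ norm_nonneg x, by simpa using hx⟩
  · exact ⟨hx.1.le, hx.2⟩

lemma volume_unit_ball_pos (n : ℕ) : 0 < volume.real (Metric.ball (0 : En n) 1) :=
  ENNReal.toReal_pos (Metric.measure_ball_pos _ _ one_pos).ne' measure_ball_lt_top.ne

lemma volume_real_ball {n : ℕ} (x : En n) {r : ℝ} (hr : 0 < r) :
    volume.real (Metric.ball x r) = r ^ n * volume.real (Metric.ball (0 : En n) 1) := by
  rw [measureReal_def, Measure.addHaar_ball_of_pos _ x hr, ENNReal.toReal_mul,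
    ENNReal.toReal_ofReal (by positivity), finrank_euclideanSpace_fin, measureReal_def]

lemma volume_real_shell_ge {n : ℕ} (hn : 1 ≤ n) {a b : ℝ} (ha : 0 ≤ a) (hab : a < b) :
    (b - a) * b ^ (n - 1) * volume.real (Metric.ball (0 : En n) 1) ≤
      volume.real (shell n a b) := by
  have heq : shell n a b = Metric.ball 0 b \ Metric.closedBall 0 a := by
    ext x
    simp [shell, and_comm]
  have hsub : Metric.ball (0 : En n) b ⊆ shell n a b ∪ Metric.closedBall 0 a := by
    rw [heq]
    exact fun x hx => (em (x ∈ Metric.closedBall (0 : En n) a)).elim Or.inr fun h => Or.inl ⟨hx, h⟩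
  have h1 : volume.real (Metric.ball (0 : En n) b) ≤
      volume.real (shell n a b) + volume.real (Metric.closedBall (0 : En n) a) :=
    (measureReal_mono hsub (measure_union_lt_top (volume_shell_ne_top n a b).lt_top
      measure_closedBall_lt_top).ne).trans (measureReal_union_le _ _)
  have h2 : volume.real (Metric.closedBall (0 : En n) a) =
      a ^ n * volume.real (Metric.ball (0 : En n) 1) := by
    have := Measure.addHaar_real_closedBall (volume : Measure (En n)) 0 ha
    simpa using this
  rw [volume_real_ball _ (ha.trans_lt hab), h2] at h1
  obtain ⟨k, rfl⟩ : ∃ k, n = k + 1 := ⟨n - 1, by omega⟩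
  have h3 : a ^ k ≤ b ^ k := pow_le_pow_left₀ ha hab.le k
  have h4 : (b - a) * b ^ k ≤ b ^ (k + 1) - a ^ (k + 1) := by
    rw [pow_succ, pow_succ]; nlinarith
  simp only [Nat.add_sub_cancel]
  nlinarith [volume_unit_ball_pos (k + 1)]

/-- Pairs of points at distance at most `3h` lying in the two outer thirds of the shell
`{a < |x| < a + 3h}`. -/
def shellPairs (n : ℕ) (a h : ℝ) : Set (En n × En n) :=
  {p | p.1 ∈ shell n a (a + h) ∧ p.2 ∈ shell n (a + 2 * h) (a + 3 * h) ∧ dist p.1 p.2 ≤ 3 * h}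

lemma measurableSet_shellPairs (n : ℕ) (a h : ℝ) : MeasurableSet (shellPairs n a h) := by
  refine (measurable_fst (isOpen_shell n _ _).measurableSet).inter
    ((measurable_snd (isOpen_shell n _ _).measurableSet).inter ?_)
  exact (isClosed_le continuous_dist continuous_const).measurableSet

lemma volume_shellPairs_ne_top (n : ℕ) (a h : ℝ) : volume (shellPairs n a h) ≠ ⊤ := by
  have hsub : shellPairs n a h ⊆ shell n a (a + h) ×ˢ shell n (a + 2 * h) (a + 3 * h) :=
    fun p hp => ⟨hp.1, hp.2.1⟩
  refine ((measure_mono hsub).trans_lt ?_).ne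
  rw [Measure.volume_eq_prod, Measure.prod_prod]
  exact ENNReal.mul_lt_top (volume_shell_ne_top _ _ _).lt_top (volume_shell_ne_top _ _ _).lt_top

lemma ball_subset_shellPairs_section {n : ℕ} {a h : ℝ} (ha : 0 ≤ a) (hh : 0 < h) {x : En n}
    (hx : x ∈ shell n a (a + h)) :
    Metric.ball (((a + 5 / 2 * h) / ‖x‖) • x) (h / 2) ⊆ Prod.mk x ⁻¹' shellPairs n a h := by
  have hx0 : 0 < ‖x‖ := ha.trans_lt hx.1
  set z : En n := ((a + 5 / 2 * h) / ‖x‖) • x with hz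
  have hnz : ‖z‖ = a + 5 / 2 * h := by
    rw [hz, norm_smul, Real.norm_of_nonneg (by positivity)]
    field_simp
  have hxz : dist x z = a + 5 / 2 * h - ‖x‖ := by
    have hsub : z - x = ((a + 5 / 2 * h) / ‖x‖ - 1) • x := by rw [hz, sub_smul, one_smul]
    have hnn : 0 ≤ (a + 5 / 2 * h) / ‖x‖ - 1 := by
      rw [sub_nonneg, one_le_div hx0]; linarith [hx.2]
    rw [dist_comm, dist_eq_norm, hsub, norm_smul, Real.norm_of_nonneg hnn]
    field_simp
  intro y hy
  have hy' : dist y z < h / 2 := hy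
  have habs : |‖y‖ - ‖z‖| < h / 2 := (abs_norm_sub_norm_le y z).trans_lt (by rwa [← dist_eq_norm])
  rw [hnz, abs_lt] at habs
  refine ⟨hx, ⟨by linarith [habs.1], by linarith [habs.2]⟩, ?_⟩
  have htri := dist_triangle_right x y z
  have := hx.1
  change dist x y ≤ 3 * h
  linarith

lemma volume_real_shellPairs_ge {n : ℕ} {a h : ℝ} (ha : 0 ≤ a) (hh : 0 < h) :
    (h / 2) ^ n * volume.real (Metric.ball (0 : En n) 1) * volume.real (shell n a (a + h)) ≤
      volume.real (shellPairs n a h) := by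
  have hball (x : En n) : volume (Metric.ball x (h / 2)) =
      ENNReal.ofReal ((h / 2) ^ n * volume.real (Metric.ball (0 : En n) 1)) := by
    rw [← volume_real_ball x (by positivity), ofReal_measureReal measure_ball_lt_top.ne]
  have key : ENNReal.ofReal ((h / 2) ^ n * volume.real (Metric.ball (0 : En n) 1)) *
      volume (shell n a (a + h)) ≤ volume (shellPairs n a h) := by
    rw [Measure.volume_eq_prod, Measure.prod_apply (measurableSet_shellPairs n a h),
      ← setLIntegral_const]
    refine (setLIntegral_mono' (isOpen_shell n _ _).measurableSet fun x hx => ?_).trans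
      (setLIntegral_le_lintegral (shell n a (a + h)) _)
    rw [← hball (((a + 5 / 2 * h) / ‖x‖) • x)]
    exact measure_mono (ball_subset_shellPairs_section ha hh hx)
  have := ENNReal.toReal_mono (volume_shellPairs_ne_top n a h) key
  rwa [ENNReal.toReal_mul, ENNReal.toReal_ofReal
    (mul_nonneg (by positivity) measureReal_nonneg)] at this

lemma gagSq_nonneg {n : ℕ} (s : ℝ) (u : En n → ℝ) (p : En n × En n) : 0 ≤ gagSq s u p :=
  div_nonneg (sq_nonneg _) (Real.rpow_nonneg dist_nonneg _)

/-- A jump of size `d` of `u` across the middle third of a shell of width `3h` is controlled by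
the Gagliardo energy. -/
lemma jump_sq_le_energy {n : ℕ} (hn : 1 ≤ n) {s a h d m : ℝ} {Ω : Set (En n)} {u : En n → ℝ}
    (hs : 0 < s) (hm : 0 < m) (ha : 0 ≤ a) (hh : 0 < h) (hd : 0 ≤ d) (hma : m ≤ a + h)
    (hu : IntegrableOn (gagSq s u) (crossSet Ω))
    (hΩ : shell n a (a + h) ⊆ Ω)
    (hjump : ∀ x ∈ shell n a (a + h), ∀ y ∈ shell n (a + 2 * h) (a + 3 * h), d ≤ |u x - u y|) :
    d ^ 2 * (volume.real (Metric.ball (0 : En n) 1) ^ 2 * m ^ (n - 1) /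
      (2 ^ n * 3 ^ ((n : ℝ) + 2 * s))) ≤
      (∫ p in crossSet Ω, gagSq s u p) * h ^ (2 * s - 1) := by
  set v := volume.real (Metric.ball (0 : En n) 1) with hv
  have hv0 : 0 < v := volume_unit_ball_pos n
  have hsub : shellPairs n a h ⊆ crossSet Ω := fun p hp => Or.inl (hΩ hp.1)
  have hlow : ∀ p ∈ shellPairs n a h, d ^ 2 / (3 * h) ^ ((n : ℝ) + 2 * s) ≤ gagSq s u p := by
    rintro ⟨x, y⟩ ⟨hx, hy, hxy⟩
    simp only at hx hy hxy
    have hdist : 0 < dist x y := by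
      refine dist_pos.2 fun hEq => ?_
      have h1 := hx.2
      have h2 := hy.1
      rw [hEq] at h1
      linarith
    have hp : 0 ≤ (n : ℝ) + 2 * s := by positivity
    exact div_le_div₀ (sq_nonneg _) (pow_le_pow_left₀ hd (hjump x hx y hy) 2)
      (Real.rpow_pos_of_pos hdist _) (Real.rpow_le_rpow hdist.le hxy hp)
  have h1 : d ^ 2 / (3 * h) ^ ((n : ℝ) + 2 * s) * volume.real (shellPairs n a h) ≤
      ∫ p in crossSet Ω, gagSq s u p :=
    (setIntegral_ge_of_const_le_real (measurableSet_shellPairs n a h)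
      (volume_shellPairs_ne_top n a h) hlow (hu.mono_set hsub)).trans
      (setIntegral_mono_set hu (Eventually.of_forall fun p => gagSq_nonneg s u p)
        hsub.eventuallyLE)
  have h2 : (h / 2) ^ n * v * (h * m ^ (n - 1) * v) ≤ volume.real (shellPairs n a h) := by
    refine le_trans ?_ (volume_real_shellPairs_ge ha hh)
    have h3 := volume_real_shell_ge hn ha (b := a + h) (by linarith)
    have h4 : m ^ (n - 1) ≤ (a + h) ^ (n - 1) := pow_le_pow_left₀ hm.le hma _
    have h5 : h * m ^ (n - 1) * v ≤ (a + h - a) * (a + h) ^ (n - 1) * v := by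
      rw [add_sub_cancel_left]; gcongr
    gcongr
    exact h5.trans h3
  have h6 := (mul_le_mul_of_nonneg_left h2
    (by positivity : 0 ≤ d ^ 2 / (3 * h) ^ ((n : ℝ) + 2 * s))).trans h1
  have h7 := mul_le_mul_of_nonneg_right h6 (Real.rpow_nonneg hh.le (2 * s - 1))
  refine le_trans (le_of_eq ?_) h7
  have h3p : (3 : ℝ) ^ ((n : ℝ) + 2 * s) ≠ 0 := (Real.rpow_pos_of_pos (by norm_num) _).ne'
  have hhp : h ^ (2 * s) ≠ 0 := (Real.rpow_pos_of_pos hh _).ne'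
  rw [Real.mul_rpow (by norm_num) hh.le, Real.rpow_add hh, Real.rpow_natCast,
    Real.rpow_sub hh, Real.rpow_one, div_pow]
  field_simp

/-- A function on `(0, L]` that is non-increasing and whose increments over `[h, 2h]` are
`O(h ^ σ)` is bounded. -/
lemma le_of_dyadic_increments {ψ : ℝ → ℝ} {L σ M : ℝ} (hL : 0 < L) (hσ : 0 < σ) (hM : 0 ≤ M)
    (hψ : AntitoneOn ψ (Icc 0 L))
    (hinc : ∀ h ∈ Ioc 0 (L / 3), ψ h - ψ (2 * h) ≤ M * h ^ σ) :
    ∀ t ∈ Ioc 0 L, ψ t ≤ ψ (L / 3) + M * (L / 3) ^ σ / (1 - (1 / 2 : ℝ) ^ σ) := by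
  set q : ℝ := (1 / 2 : ℝ) ^ σ with hq
  have hq0 : 0 < q := Real.rpow_pos_of_pos (by norm_num) _
  have hq1 : q < 1 := Real.rpow_lt_one (by norm_num) (by norm_num) hσ
  have hB : 0 ≤ M * (L / 3) ^ σ := by positivity
  have hB' : 0 ≤ M * (L / 3) ^ σ / (1 - q) := div_nonneg hB (by linarith)
  have hind : ∀ k : ℕ, ψ (L / 3 * (1 / 2) ^ k) ≤
      ψ (L / 3) + M * (L / 3) ^ σ / (1 - q) * (1 - q ^ k) := by
    intro k
    induction k with
    | zero => simp
    | succ k ih =>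
      have hpow : ((1 / 2 : ℝ)) ^ (k + 1) ≤ 1 := pow_le_one₀ (by norm_num) (by norm_num)
      have h1 := hinc (L / 3 * (1 / 2) ^ (k + 1)) ⟨by positivity, by nlinarith⟩
      have h2 : 2 * (L / 3 * (1 / 2) ^ (k + 1)) = L / 3 * (1 / 2) ^ k := by rw [pow_succ]; ring
      have h3 : (L / 3 * (1 / 2) ^ (k + 1)) ^ σ = (L / 3) ^ σ * q ^ (k + 1) := by
        rw [Real.mul_rpow (by positivity) (by positivity), hq, ← Real.rpow_natCast,
          ← Real.rpow_natCast, ← Real.rpow_mul (by norm_num), ← Real.rpow_mul (by norm_num),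
          mul_comm σ]
      rw [h2, h3] at h1
      have h4 : q ^ (k + 1) ≤ q ^ k := pow_le_pow_of_le_one hq0.le hq1.le (by omega)
      have h5 : M * (L / 3) ^ σ / (1 - q) * (1 - q ^ (k + 1)) =
          M * (L / 3) ^ σ / (1 - q) * (1 - q ^ k) + M * (L / 3) ^ σ * q ^ k := by
        have : 1 - q ≠ 0 := by linarith
        field_simp
        ring
      nlinarith [mul_le_mul_of_nonneg_left h4 hB]
  rintro t ⟨ht0, htL⟩
  obtain ⟨k, hk⟩ := exists_pow_lt_of_lt_one (div_pos ht0 (by linarith : 0 < L / 3))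
    (by norm_num : (1 / 2 : ℝ) < 1)
  have hkt : L / 3 * (1 / 2) ^ k ≤ t := by
    rw [lt_div_iff₀ (by linarith)] at hk; linarith
  have hqk : 0 < q ^ k := pow_pos hq0 k
  have h1 := hψ ⟨by positivity, hkt.trans htL⟩ ⟨ht0.le, htL⟩ hkt
  nlinarith [hind k]

/-- Uniform bound for profiles `ψ` that are non-increasing in the distance to a boundary sphere. -/
lemma exists_profile_bound {n : ℕ} (hn : 1 ≤ n) {s c m L : ℝ} (hs : 1 / 2 < s) (hc : 0 < c)
    (hm : 0 < m) (hL : 0 < L) :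
    ∃ C > (0 : ℝ), ∀ (Ω : Set (En n)) (u : En n → ℝ) (ψ : ℝ → ℝ),
      MemHs s Ω u → AntitoneOn ψ (Icc 0 L) → 0 ≤ ψ (L / 3) →
      (∀ h ∈ Ioc 0 (L / 3), ∃ a, 0 ≤ a ∧ m ≤ a + h ∧ shell n a (a + h) ⊆ Ω ∧
        ∀ x ∈ shell n a (a + h), ∀ y ∈ shell n (a + 2 * h) (a + 3 * h),
          ψ h - ψ (2 * h) ≤ |u x - u y|) →
      (∃ a, 0 ≤ a ∧ m ≤ a + L / 3 ∧ shell n a (a + L / 3) ⊆ Ω ∧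
        ∀ x ∈ shell n a (a + L / 3), ψ (L / 3) ≤ u x) →
      ∀ t ∈ Ioc 0 L, ψ t ≤ C * HsNorm c s Ω u := by
  set v := volume.real (Metric.ball (0 : En n) 1) with hv
  have hv0 : 0 < v := volume_unit_ball_pos n
  set κ := v ^ 2 * m ^ (n - 1) / (2 ^ n * 3 ^ ((n : ℝ) + 2 * s)) with hκ
  have hκ0 : 0 < κ := by positivity
  set V := L / 3 * m ^ (n - 1) * v with hV
  have hV0 : 0 < V := by positivity
  have hσ : 0 < s - 1 / 2 := by linarith
  set D := (L / 3) ^ (s - 1 / 2) / (1 - (1 / 2 : ℝ) ^ (s - 1 / 2)) with hD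
  have hD0 : 0 < D := div_pos (by positivity)
    (sub_pos.2 (Real.rpow_lt_one (by norm_num) (by norm_num) hσ))
  refine ⟨(√V)⁻¹ + D / √(κ * (c / 2)), by positivity, ?_⟩
  intro Ω u ψ hu hψ hψ0 hjump hL2 t ht
  set G := ∫ p in crossSet Ω, gagSq s u p with hG
  have hG0 : 0 ≤ G := integral_nonneg fun p => gagSq_nonneg s u p
  set N := ∫ x in Ω, (u x) ^ 2 with hN
  have hN0 : 0 ≤ N := integral_nonneg fun x => sq_nonneg _
  have hnorm : HsNorm c s Ω u = √N + √(c / 2) * √G := by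
    unfold HsNorm seminormSq
    rw [← Real.sqrt_eq_rpow, ← Real.sqrt_eq_rpow, Real.sqrt_mul (by positivity)]
  have hinc : ∀ h ∈ Ioc 0 (L / 3), ψ h - ψ (2 * h) ≤ √(G / κ) * h ^ (s - 1 / 2) := by
    rintro h ⟨hh, hhL⟩
    obtain ⟨a, ha, hma, hsub, hj⟩ := hjump h ⟨hh, hhL⟩
    have hd : 0 ≤ ψ h - ψ (2 * h) :=
      sub_nonneg.2 (hψ ⟨hh.le, by linarith⟩ ⟨by linarith, by linarith⟩ (by linarith))
    have h1 := jump_sq_le_energy hn (by linarith) hm ha hh hd hma hu.2.2 hsub hj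
    refine le_of_sq_le_sq ?_ (by positivity)
    rw [mul_pow, Real.sq_sqrt (by positivity), ← Real.rpow_natCast (h ^ _), ← Real.rpow_mul hh.le,
      div_mul_eq_mul_div, le_div_iff₀ hκ0,
      show (s - 1 / 2) * ((2 : ℕ) : ℝ) = 2 * s - 1 by push_cast; ring]
    exact h1
  have hstart : ψ (L / 3) ≤ (√V)⁻¹ * √N := by
    obtain ⟨a, ha, hma, hsub, hle⟩ := hL2
    have h1 : ψ (L / 3) ^ 2 * volume.real (shell n a (a + L / 3)) ≤ N :=
      (setIntegral_ge_of_const_le_real (isOpen_shell n _ _).measurableSet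
        (volume_shell_ne_top n _ _) (fun x hx => pow_le_pow_left₀ hψ0 (hle x hx) 2)
        (hu.2.1.mono_set hsub)).trans
        (setIntegral_mono_set hu.2.1 (Eventually.of_forall fun x => sq_nonneg _)
          hsub.eventuallyLE)
    have h2 : V ≤ volume.real (shell n a (a + L / 3)) := by
      refine le_trans ?_ (volume_real_shell_ge hn ha (by linarith))
      rw [add_sub_cancel_left, hV]
      gcongr
    rw [← Real.sqrt_inv, ← Real.sqrt_mul (by positivity)]
    refine Real.le_sqrt_of_sq_le ?_
    rw [inv_mul_eq_div, le_div_iff₀ hV0]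
    exact (mul_le_mul_of_nonneg_left h2 (sq_nonneg _)).trans h1
  have hmain := le_of_dyadic_increments hL hσ (Real.sqrt_nonneg (G / κ)) hψ hinc t ht
  have htail : √(G / κ) * (L / 3) ^ (s - 1 / 2) / (1 - (1 / 2 : ℝ) ^ (s - 1 / 2)) =
      D / √(κ * (c / 2)) * (√(c / 2) * √G) := by
    rw [mul_div_assoc, ← hD, Real.sqrt_div hG0, Real.sqrt_mul hκ0.le]
    have : √κ ≠ 0 := by positivity
    have : √(c / 2) ≠ 0 := by positivity
    field_simp
  rw [htail] at hmain
  rw [hnorm]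
  have h1 : 0 ≤ (√V)⁻¹ * (√(c / 2) * √G) := by positivity
  have h2 : 0 ≤ D / √(κ * (c / 2)) * √N := by positivity
  linarith

/-- L∞ bound on the cones `𝒞₊(Ω)` and (for `R₀ > 0`) `𝒞₋(A_{R₀,R})`. -/
theorem statement7 {n : ℕ} (hn : 1 ≤ n) {s c R₀ R : ℝ}
    (hs : s ∈ Ioo (1/2 : ℝ) 1) (hc : 0 < c) (hR₀ : 0 ≤ R₀) (hR : R₀ < R)
    (Ω : Set (En n)) (hΩ : Ω = annR n R₀ R) :
    ∃ C > (0:ℝ),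
      (∀ u : En n → ℝ, InConePlus s R₀ R Ω u →
        ∀ᵐ x ∂(volume.restrict Ω), |u x| ≤ C * HsNorm c s Ω u) ∧
      (0 < R₀ → ∀ u : En n → ℝ, InConeMinus s R₀ R Ω u →
        ∀ᵐ x ∂(volume.restrict Ω), |u x| ≤ C * HsNorm c s Ω u) := by
  have hL : 0 < R - R₀ := by linarith
  obtain ⟨m, hm, hm1, hm2⟩ : ∃ m > 0, m ≤ R₀ + (R - R₀) / 3 ∧ (0 < R₀ → m ≤ R₀) := by
    rcases hR₀.eq_or_lt with h | h
    · exact ⟨(R - R₀) / 3, by linarith, by linarith, fun h' => by linarith⟩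
    · exact ⟨R₀, h, by linarith, fun _ => le_rfl⟩
  have hΩm : MeasurableSet Ω := by
    rw [hΩ, annR]
    split_ifs
    · exact measurableSet_ball
    · exact (isOpen_shell n R₀ R).measurableSet
  obtain ⟨C, hC, hbound⟩ := exists_profile_bound hn hs.1 hc hm hL
  have hsub : ∀ a b, R₀ ≤ a → b ≤ R → shell n a b ⊆ Ω := fun a b ha hb =>
    hΩ ▸ shell_subset_annR ha hb
  refine ⟨C, hC, ?_, ?_⟩
  · rintro u ⟨hu, hpos, φ, hφ, hmono⟩
    have hprofile : ∀ t ∈ Ioc 0 (R - R₀), φ (R - t) ≤ C * HsNorm c s Ω u := by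
      refine hbound Ω u (fun t => φ (R - t)) hu ?_ ?_ ?_ ?_
      · intro t ht t' ht' htt'
        exact hmono ⟨by linarith [ht'.2], by linarith [ht'.1]⟩
          ⟨by linarith [ht.2], by linarith [ht.1]⟩ (by linarith)
      · obtain ⟨e, he⟩ : ∃ e : En n, ‖e‖ = R - (R - R₀) / 3 := by
          have : Nonempty (Fin n) := ⟨⟨0, hn⟩⟩
          exact exists_norm_eq (En n) (by linarith)
        have := hpos e
        rwa [hφ, he] at this
      · rintro h ⟨hh, hhL⟩
        refine ⟨R - 3 * h, by linarith, by linarith, hsub _ _ (by linarith) (by linarith), ?_⟩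
        intro x hx y hy
        have h1 := hx.1
        have h2 := hx.2
        have h3 := hy.1
        have h4 := hy.2
        rw [hφ x, hφ y, abs_sub_comm]
        have h5 : φ ‖x‖ ≤ φ (R - 2 * h) :=
          hmono ⟨by linarith, by linarith⟩ ⟨by linarith, by linarith⟩ (by linarith)
        have h6 : φ (R - h) ≤ φ ‖y‖ :=
          hmono ⟨by linarith, by linarith⟩ ⟨by linarith, by linarith⟩ (by linarith)
        exact le_trans (by linarith) (le_abs_self _)
      · refine ⟨R - (R - R₀) / 3, by linarith, by linarith,
          hsub _ _ (by linarith) (by linarith), ?_⟩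
        intro x hx
        have h1 := hx.1
        have h2 := hx.2
        rw [hφ x]
        exact hmono ⟨by linarith, by linarith⟩ ⟨by linarith, by linarith⟩ h1.le
    filter_upwards [ae_restrict_mem hΩm] with x hx
    obtain ⟨h1, h2⟩ := norm_mem_of_mem_annR (hΩ ▸ hx)
    have := hprofile (R - ‖x‖) ⟨by linarith, by linarith⟩
    rwa [sub_sub_cancel, ← hφ x, ← abs_of_nonneg (hpos x)] at this
  · rintro hR₀pos u ⟨hu, hpos, φ, hφ, hanti⟩
    have hmR := hm2 hR₀pos
    have hprofile : ∀ t ∈ Ioc 0 (R - R₀), φ (R₀ + t) ≤ C * HsNorm c s Ω u := by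
      refine hbound Ω u (fun t => φ (R₀ + t)) hu ?_ ?_ ?_ ?_
      · intro t ht t' ht' htt'
        exact hanti ⟨by linarith [ht.1], by linarith [ht.2]⟩
          ⟨by linarith [ht'.1], by linarith [ht'.2]⟩ (by linarith)
      · obtain ⟨e, he⟩ : ∃ e : En n, ‖e‖ = R₀ + (R - R₀) / 3 := by
          have : Nonempty (Fin n) := ⟨⟨0, hn⟩⟩
          exact exists_norm_eq (En n) (by linarith)
        have := hpos e
        rwa [hφ, he] at this
      · rintro h ⟨hh, hhL⟩
        refine ⟨R₀, by linarith, by linarith, hsub _ _ (by linarith) (by linarith), ?_⟩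
        intro x hx y hy
        have h1 := hx.1
        have h2 := hx.2
        have h3 := hy.1
        have h4 := hy.2
        rw [hφ x, hφ y]
        have h5 : φ (R₀ + h) ≤ φ ‖x‖ :=
          hanti ⟨by linarith, by linarith⟩ ⟨by linarith, by linarith⟩ (by linarith)
        have h6 : φ ‖y‖ ≤ φ (R₀ + 2 * h) :=
          hanti ⟨by linarith, by linarith⟩ ⟨by linarith, by linarith⟩ (by linarith)
        exact le_trans (by linarith) (le_abs_self _)
      · refine ⟨R₀, by linarith, by linarith, hsub _ _ (by linarith) (by linarith), ?_⟩
        intro x hx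
        have h1 := hx.1
        have h2 := hx.2
        rw [hφ x]
        exact hanti ⟨by linarith, by linarith⟩ ⟨by linarith, by linarith⟩ h2.le
    filter_upwards [ae_restrict_mem hΩm] with x hx
    have hx' : R₀ < ‖x‖ ∧ ‖x‖ < R := by
      rw [hΩ, annR, if_neg hR₀pos.ne'] at hx
      exact hx
    have := hprofile (‖x‖ - R₀) ⟨by linarith [hx'.1], by linarith [hx'.2]⟩
    rwa [add_sub_cancel, ← hφ x, ← abs_of_nonneg (hpos x)] at this

end
end

section
/- Let n ≥ 1, s ∈ (1/2,1), 0 ≤ R₀ < R, Ω = A_{R₀,R}, and let M, δ > 0 and g ∈ 𝔉_{M,δ}. If u belongs to the cone 𝒞₊(Ω) (or to 𝒞₋(A_{R₀,R}) when R₀ > 0) and u is a weak solution of (−Δ)^s u + u = g(u) in Ω with 𝒩_s u = 0 in ℝⁿ ∖ cl(Ω), then ∫_Ω u dx ≤ M |Ω| (1 + 1/δ), where |Ω| is the Lebesgue measure of Ω. -/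
open MeasureTheory Filter Set

noncomputable section

/-- The annulus lies in a ball, so it has finite measure. -/
lemma volume_annR_lt_top (n : ℕ) (R₀ R : ℝ) : volume (annR n R₀ R) < ⊤ := by
  refine (measure_mono (t := Metric.ball (0 : En n) R) ?_).trans_lt measure_ball_lt_top
  intro x hx
  unfold annR at hx
  split_ifs at hx with h
  · exact hx
  · simpa using hx.2

/-- Constants belong to `H^s_{Ω,0}` when `Ω` has finite measure. -/
lemma memHs_const {n : ℕ} (s : ℝ) {Ω : Set (En n)} (hΩ : volume Ω < ⊤) (a : ℝ) :
    MemHs s Ω (fun _ => a) := by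
  refine ⟨measurable_const, integrableOn_const hΩ.ne, ?_⟩
  have h : gagSq s (fun _ : En n => a) = fun _ => 0 := by
    funext p
    simp [gagSq]
  rw [h]
  exact integrableOn_zero

/-- Testing with the constant `1`: solutions of the Neumann problem have the mass of the datum. -/
lemma SolvesLin.integral_eq {n : ℕ} {c s : ℝ} {Ω : Set (En n)} {h u : En n → ℝ}
    (hΩ : volume Ω < ⊤) (hu : SolvesLin c s Ω h u) :
    IntegrableOn u Ω ∧ IntegrableOn h Ω ∧ ∫ x in Ω, u x = ∫ x in Ω, h x := by
  obtain ⟨-, h_u, h_h, heq⟩ := hu.2 _ (memHs_const s hΩ 1)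
  simp only [mul_one] at h_u h_h heq
  exact ⟨h_u, h_h, by simpa [gagBil] using heq⟩

/-- L¹ a priori bound for solutions in the cone with nonlinearity in `𝔉_{M,δ}`. -/
theorem statement8 {n : ℕ} (hn : 1 ≤ n) {s c R₀ R M δ : ℝ}
    (hs : s ∈ Ioo (1/2 : ℝ) 1) (hc : 0 < c) (hR₀ : 0 ≤ R₀) (hR : R₀ < R)
    (hM : 0 < M) (hδ : 0 < δ)
    (Ω : Set (En n)) (hΩ : Ω = annR n R₀ R)
    (g : ℝ → ℝ) (hgcont : ContinuousOn g (Ici 0))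
    (hgnonneg : ∀ t ∈ Ici (0:ℝ), 0 ≤ g t)
    (hggrowth : ∀ t ≥ M, (1 + δ) * t ≤ g t)
    (u : En n → ℝ)
    (hcone : InConePlus s R₀ R Ω u ∨ (0 < R₀ ∧ InConeMinus s R₀ R Ω u))
    (hsol : IsWeakSolution c s Ω g u) :
    ∫ x in Ω, u x ≤ M * (volume Ω).toReal * (1 + 1/δ) := by
  have hfin : volume Ω < ⊤ := hΩ ▸ volume_annR_lt_top n R₀ R
  obtain ⟨hu0, hlin⟩ := hsol
  obtain ⟨h_u, h_g, heq⟩ := hlin.integral_eq hfin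
  have hconst : IntegrableOn (fun _ : En n => (1 + δ) * M) Ω := integrableOn_const hfin.ne
  have hle : ∫ x in Ω, ((1 + δ) * u x - (1 + δ) * M) ≤ ∫ x in Ω, g (u x) := by
    refine integral_mono_ae ((h_u.const_mul _).sub hconst) h_g ?_
    filter_upwards [hu0] with x hx
    rcases le_total M (u x) with h | h
    · have := hggrowth _ h
      nlinarith
    · have := hgnonneg _ hx
      nlinarith
  rw [integral_sub (h_u.const_mul _) hconst, integral_const_mul, setIntegral_const,
    ← heq, smul_eq_mul, measureReal_def] at hle
  have hrhs : M * (volume Ω).toReal * (1 + 1 / δ)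
      = (volume Ω).toReal * ((1 + δ) * M) / δ := by
    field_simp
    ring
  rw [hrhs, le_div_iff₀ hδ]
  linarith

end
end

section
/- Let n ≥ 1, s ∈ (1/2,1), 0 ≤ R₀ < R, Ω = A_{R₀,R}, and let M, δ > 0. There exist constants K_∞ > 0 and K₂ > 0, depending only on R₀, R, n, s, M, δ, such that for every g ∈ 𝔉_{M,δ} and every u in the cone 𝒞₊(Ω) (or 𝒞₋(A_{R₀,R}) when R₀ > 0) that is a weak solution of (−Δ)^s u + u = g(u) in Ω with 𝒩_s u = 0 in ℝⁿ ∖ cl(Ω), one has ess sup_Ω |u| ≤ K_∞ and ‖u‖_{H^s_{Ω,0}} ≤ K₂. -/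
open MeasureTheory Filter Set

noncomputable section

/-- The open spherical shell `{x : a < |x| < b}`. -/
def openShell (n : ℕ) (a b : ℝ) : Set (En n) := {x : En n | a < ‖x‖ ∧ ‖x‖ < b}

/-- The volume of the unit ball of `ℝⁿ`. -/
def unitBallVolume (n : ℕ) : ℝ := (volume : Measure (En n)).real (Metric.ball 0 1)

lemma unitBallVolume_pos (n : ℕ) : 0 < unitBallVolume n :=
  ENNReal.toReal_pos (Metric.measure_ball_pos volume _ one_pos).ne' measure_ball_lt_top.ne

lemma volume_real_ball_eq {n : ℕ} (x : En n) {r : ℝ} (hr : 0 < r) :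
    volume.real (Metric.ball x r) = r ^ n * unitBallVolume n := by
  rw [Measure.real, Measure.addHaar_ball_of_pos _ _ hr, ENNReal.toReal_mul,
    ENNReal.toReal_ofReal (by positivity), finrank_euclideanSpace, Fintype.card_fin]
  rfl

lemma isOpen_openShell (n : ℕ) (a b : ℝ) : IsOpen (openShell n a b) :=
  (isOpen_lt continuous_const continuous_norm).inter (isOpen_lt continuous_norm continuous_const)

lemma openShell_subset_ball (n : ℕ) (a b : ℝ) : openShell n a b ⊆ Metric.ball 0 b :=
  fun x hx => by simpa using hx.2

lemma volume_openShell_ne_top (n : ℕ) (a b : ℝ) : volume (openShell n a b) ≠ ⊤ :=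
  measure_ne_top_of_subset (openShell_subset_ball n a b) measure_ball_lt_top.ne

lemma le_volume_real_openShell {n : ℕ} (hn : 1 ≤ n) {p t : ℝ} (hp : 0 ≤ p) (ht : 0 < t) :
    unitBallVolume n * (t * (p + t) ^ (n - 1)) ≤ volume.real (openShell n p (p + t)) := by
  have hsub : Metric.ball (0 : En n) (p + t) ⊆ Metric.closedBall 0 p ∪ openShell n p (p + t) := by
    intro x hx
    by_cases h : ‖x‖ ≤ p
    · left; simpa using h
    · right; exact ⟨not_le.mp h, by simpa using hx⟩
  have h1 : volume.real (Metric.ball (0 : En n) (p + t)) ≤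
      volume.real (Metric.closedBall (0 : En n) p) + volume.real (openShell n p (p + t)) :=
    (measureReal_mono hsub
      (measure_union_ne_top measure_closedBall_lt_top.ne (volume_openShell_ne_top _ _ _))).trans
      (measureReal_union_le _ _)
  rw [volume_real_ball_eq _ (by linarith), Measure.addHaar_real_closedBall _ _ hp,
    finrank_euclideanSpace, Fintype.card_fin, ← unitBallVolume] at h1
  have h2 : p ^ n ≤ p * (p + t) ^ (n - 1) := by
    obtain ⟨m, rfl⟩ : ∃ m, n = m + 1 := ⟨n - 1, by omega⟩
    rw [pow_succ', Nat.add_sub_cancel]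
    gcongr
    linarith
  have h3 : (p + t) ^ n = p * (p + t) ^ (n - 1) + t * (p + t) ^ (n - 1) := by
    obtain ⟨m, rfl⟩ : ∃ m, n = m + 1 := ⟨n - 1, by omega⟩
    rw [pow_succ', Nat.add_sub_cancel]
    ring
  have := unitBallVolume_pos n
  nlinarith [mul_le_mul_of_nonneg_right h2 this.le]

/-- Pairs of points of two spherical shells at distance at most `4 * t`. -/
def nearPairs (n : ℕ) (p q t : ℝ) : Set (En n × En n) :=
  {z | z.1 ∈ openShell n p (p + t) ∧ z.2 ∈ openShell n q (q + 2 * t) ∧ dist z.1 z.2 ≤ 4 * t}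

lemma measurableSet_nearPairs (n : ℕ) (p q t : ℝ) : MeasurableSet (nearPairs n p q t) := by
  refine (measurable_fst (isOpen_openShell n p (p + t)).measurableSet).inter
    ((measurable_snd (isOpen_openShell n q (q + 2 * t)).measurableSet).inter ?_)
  exact measurableSet_le (continuous_fst.dist continuous_snd).measurable measurable_const

lemma volume_nearPairs_ne_top (n : ℕ) (p q t : ℝ) : volume (nearPairs n p q t) ≠ ⊤ := by
  refine measure_ne_top_of_subset
    (show nearPairs n p q t ⊆ openShell n p (p + t) ×ˢ openShell n q (q + 2 * t) from
      fun z hz => ⟨hz.1, hz.2.1⟩) ?_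
  rw [Measure.volume_eq_prod, Measure.prod_prod]
  exact ENNReal.mul_ne_top (volume_openShell_ne_top _ _ _) (volume_openShell_ne_top _ _ _)

lemma exists_ball_subset_nearPairs_slice {n : ℕ} {p q t : ℝ} (hp : 0 ≤ p) (hq : 0 ≤ q) (ht : 0 < t)
    (hpq : ∀ r ∈ Ioo p (p + t), |r - (q + t)| ≤ 3 * t) {x : En n}
    (hx : x ∈ openShell n p (p + t)) :
    ∃ z, Metric.ball z t ⊆ Prod.mk x ⁻¹' nearPairs n p q t := by
  have hx0 : 0 < ‖x‖ := hp.trans_lt hx.1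
  set z : En n := ((q + t) / ‖x‖) • x with hz
  have hzn : ‖z‖ = q + t := by
    rw [hz, norm_smul, Real.norm_of_nonneg (by positivity)]
    field_simp
  have hxz : dist x z ≤ 3 * t := by
    have h : x - z = (1 - (q + t) / ‖x‖) • x := by rw [hz, sub_smul, one_smul]
    rw [dist_eq_norm, h, norm_smul, Real.norm_eq_abs, ← abs_of_pos hx0, ← abs_mul,
      abs_of_pos hx0, sub_mul, one_mul, div_mul_cancel₀ _ hx0.ne']
    exact hpq _ hx
  refine ⟨z, fun y hy => ⟨hx, ?_, ?_⟩⟩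
  · rw [Metric.mem_ball, dist_eq_norm] at hy
    have h' := (abs_norm_sub_norm_le y z).trans_lt hy
    rw [hzn] at h'
    have := abs_lt.mp h'
    constructor <;> dsimp only <;> linarith
  · have h := dist_triangle x z y
    rw [Metric.mem_ball, dist_comm] at hy
    dsimp only
    linarith

lemma le_volume_real_nearPairs {n : ℕ} (hn : 1 ≤ n) {p q t : ℝ} (hp : 0 ≤ p) (hq : 0 ≤ q)
    (ht : 0 < t) (hpq : ∀ r ∈ Ioo p (p + t), |r - (q + t)| ≤ 3 * t) :
    unitBallVolume n * (t * (p + t) ^ (n - 1)) * (t ^ n * unitBallVolume n) ≤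
      volume.real (nearPairs n p q t) := by
  refine (mul_le_mul_of_nonneg_right (le_volume_real_openShell hn hp ht)
    (mul_nonneg (by positivity) (unitBallVolume_pos n).le)).trans ?_
  rw [← volume_real_ball_eq (0 : En n) ht, Measure.real, Measure.real, ← ENNReal.toReal_mul]
  refine ENNReal.toReal_mono (volume_nearPairs_ne_top n p q t) ?_
  rw [Measure.volume_eq_prod, Measure.prod_apply (measurableSet_nearPairs n p q t)]
  refine le_trans ?_ (setLIntegral_le_lintegral (openShell n p (p + t)) _)
  rw [mul_comm, ← setLIntegral_const]
  refine setLIntegral_mono' (isOpen_openShell n p (p + t)).measurableSet fun x hx => ?_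
  obtain ⟨z, hz⟩ := exists_ball_subset_nearPairs_slice hp hq ht hpq hx
  rw [Measure.addHaar_ball_center volume (0 : En n), ← Measure.addHaar_ball_center volume z]
  exact measure_mono hz

/-- The oscillation of a radial function across two neighbouring shells of width `t` is controlled
by its Gagliardo energy. -/
lemma sq_mul_le_integral_gagSq {n : ℕ} (hn : 1 ≤ n) {s p q t d ρ : ℝ} (hs : 0 ≤ s) (hp : 0 ≤ p)
    (hq : 0 ≤ q) (ht : 0 < t) (hρ : 0 ≤ ρ) (hρp : ρ ≤ p + t) (hd : 0 ≤ d)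
    (hpq : ∀ r ∈ Ioo p (p + t), |r - (q + t)| ≤ 3 * t)
    {Ω : Set (En n)} (hsub : openShell n p (p + t) ⊆ Ω)
    {u : En n → ℝ} (hu : IntegrableOn (gagSq s u) (crossSet Ω))
    (hosc : ∀ x ∈ openShell n p (p + t), ∀ y ∈ openShell n q (q + 2 * t), d ≤ |u x - u y|) :
    d ^ 2 * ((unitBallVolume n) ^ 2 * ρ ^ (n - 1) / 4 ^ ((n : ℝ) + 2 * s) * t ^ (1 - 2 * s)) ≤
      ∫ z in crossSet Ω, gagSq s u z := by
  have hα : 0 ≤ (n : ℝ) + 2 * s := by positivity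
  have hPsub : nearPairs n p q t ⊆ crossSet Ω := fun z hz => Or.inl (hsub hz.1)
  have hω := unitBallVolume_pos n
  have hvol := le_volume_real_nearPairs hn hp hq ht hpq
  have hpt : (4 * t) ^ ((n : ℝ) + 2 * s) = 4 ^ ((n : ℝ) + 2 * s) * (t ^ n * t) / t ^ (1 - 2 * s) := by
    rw [Real.mul_rpow (by norm_num) ht.le, eq_div_iff (by positivity), mul_assoc,
      ← Real.rpow_add ht, ← pow_succ, ← Real.rpow_natCast t (n + 1)]
    congr 2
    push_cast
    ring
  calc d ^ 2 * ((unitBallVolume n) ^ 2 * ρ ^ (n - 1) / 4 ^ ((n : ℝ) + 2 * s) * t ^ (1 - 2 * s))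
      ≤ d ^ 2 * ((unitBallVolume n) ^ 2 * (p + t) ^ (n - 1) / 4 ^ ((n : ℝ) + 2 * s)
          * t ^ (1 - 2 * s)) := by gcongr
    _ = d ^ 2 / (4 * t) ^ ((n : ℝ) + 2 * s) *
          (unitBallVolume n * (t * (p + t) ^ (n - 1)) * (t ^ n * unitBallVolume n)) := by
        rw [hpt]
        have h4 : (4 : ℝ) ^ ((n : ℝ) + 2 * s) ≠ 0 := (Real.rpow_pos_of_pos (by norm_num) _).ne'
        have h5 : t ^ (1 - 2 * s) ≠ 0 := (Real.rpow_pos_of_pos ht _).ne'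
        field_simp
    _ ≤ d ^ 2 / (4 * t) ^ ((n : ℝ) + 2 * s) * volume.real (nearPairs n p q t) := by gcongr
    _ = ∫ _z in nearPairs n p q t, d ^ 2 / (4 * t) ^ ((n : ℝ) + 2 * s) := by
        rw [setIntegral_const, smul_eq_mul, mul_comm]
    _ ≤ ∫ z in nearPairs n p q t, gagSq s u z := by
        refine setIntegral_mono_on (integrableOn_const (volume_nearPairs_ne_top n p q t))
          (hu.mono_set hPsub) (measurableSet_nearPairs n p q t) fun z hz => ?_
        have h := hosc _ hz.1 _ hz.2.1
        rcases (dist_nonneg (x := z.1) (y := z.2)).eq_or_lt with h0 | h0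
        · have h1 : z.1 = z.2 := dist_eq_zero.mp h0.symm
          have h2 : d = 0 := le_antisymm (by simpa [h1] using h) hd
          rw [h2]
          simpa using gagSq_nonneg s u z
        · unfold gagSq
          have := Real.rpow_pos_of_pos h0 ((n : ℝ) + 2 * s)
          gcongr
          exact hz.2.2
    _ ≤ ∫ z in crossSet Ω, gagSq s u z :=
        setIntegral_mono_set hu (Eventually.of_forall (gagSq_nonneg s u)) hPsub.eventuallyLE

/-- A profile whose dyadic increments are Hölder small stays bounded up to the endpoint `0`. -/
lemma le_of_dyadic_increment {ψ : ℝ → ℝ} {T D σ : ℝ} (hT : 0 < T) (hσ : 0 < σ) (hD : 0 ≤ D)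
    (hψ : AntitoneOn ψ (Icc 0 (4 * T)))
    (hinc : ∀ t, 0 < t → t ≤ T → ψ t - ψ (2 * t) ≤ D * t ^ σ) {τ : ℝ} (hτ : τ ∈ Ioc 0 (4 * T)) :
    ψ τ ≤ ψ T + D / (2 ^ σ - 1) * T ^ σ := by
  have h2 : 0 < (2 : ℝ) ^ σ - 1 := sub_pos.mpr (Real.one_lt_rpow (by norm_num) hσ)
  have key : ∀ k : ℕ, ψ (T / 2 ^ k) ≤
      ψ T + D / (2 ^ σ - 1) * T ^ σ - D / (2 ^ σ - 1) * (T / 2 ^ k) ^ σ := by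
    intro k
    induction k with
    | zero => simp
    | succ k ih =>
      have h := hinc (T / 2 ^ (k + 1)) (by positivity)
        (div_le_self hT.le (one_le_pow₀ (by norm_num)))
      have e : T / 2 ^ k = 2 * (T / 2 ^ (k + 1)) := by field_simp; ring
      rw [e, Real.mul_rpow (by norm_num) (by positivity)] at ih
      have e2 : D / (2 ^ σ - 1) * (2 ^ σ * (T / 2 ^ (k + 1)) ^ σ) =
          D * (T / 2 ^ (k + 1)) ^ σ + D / (2 ^ σ - 1) * (T / 2 ^ (k + 1)) ^ σ := by
        field_simp
        ring
      linarith
  obtain ⟨k, hk⟩ := exists_pow_lt_of_lt_one (div_pos hτ.1 hT) (show (1 / 2 : ℝ) < 1 by norm_num)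
  have hk' : T / 2 ^ k ≤ τ := by
    rw [lt_div_iff₀ hT] at hk
    calc T / 2 ^ k = (1 / 2) ^ k * T := by rw [one_div, inv_pow]; field_simp
      _ ≤ τ := hk.le
  have h0 : 0 < T / 2 ^ k := by positivity
  have h1 := hψ ⟨h0.le, hk'.trans hτ.2⟩ ⟨hτ.1.le, hτ.2⟩ hk'
  have h3 : 0 ≤ D / (2 ^ σ - 1) * (T / 2 ^ k) ^ σ := by positivity
  linarith [key k]

lemma memHs_one {n : ℕ} (s : ℝ) {Ω : Set (En n)} (hΩ : volume Ω ≠ ⊤) :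
    MemHs s Ω (fun _ : En n => (1 : ℝ)) := by
  refine ⟨measurable_const, integrableOn_const (by simpa using hΩ), ?_⟩
  have : gagSq s (fun _ : En n => (1 : ℝ)) = fun _ => 0 := by ext p; simp [gagSq]
  rw [this]
  exact integrableOn_zero

lemma gagBil_self {n : ℕ} (s : ℝ) (u : En n → ℝ) : gagBil s u u = gagSq s u := by
  ext p; simp [gagBil, gagSq, sq]

/-- Testing the equation with the constant function `1` bounds the mass of a solution. -/
lemma integral_le_of_isWeakSolution {n : ℕ} {c s M δ : ℝ} {Ω : Set (En n)} (hΩm : MeasurableSet Ω)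
    (hΩ : volume Ω ≠ ⊤) (hM : 0 ≤ M) (hδ : 0 < δ) {g : ℝ → ℝ} (hg0 : ∀ t ∈ Ici (0:ℝ), 0 ≤ g t)
    (hg : ∀ t ≥ M, (1 + δ) * t ≤ g t) {u : En n → ℝ} (hu : ∀ x, 0 ≤ u x)
    (hw : IsWeakSolution c s Ω g u) :
    IntegrableOn u Ω ∧ IntegrableOn (fun x => g (u x)) Ω ∧
      ∫ x in Ω, g (u x) = ∫ x in Ω, u x ∧
      ∫ x in Ω, u x ≤ (1 + δ) * M * volume.real Ω / δ := by
  obtain ⟨-, h1, h2, h3⟩ := hw.2.2 _ (memHs_one s hΩ)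
  simp only [mul_one] at h1 h2 h3
  have h0 : gagBil s u (fun _ => 1) = fun _ => 0 := by ext p; simp [gagBil]
  rw [h0, integral_zero, mul_zero, zero_add] at h3
  refine ⟨h1, h2, h3.symm, ?_⟩
  have hpt : ∀ x ∈ Ω, (1 + δ) * u x - (1 + δ) * M ≤ g (u x) := by
    intro x _
    rcases le_total M (u x) with h | h
    · have := hg _ h
      have : 0 ≤ (1 + δ) * M := by positivity
      linarith
    · have := hg0 _ (hu x)
      nlinarith
  have hint : IntegrableOn (fun x => (1 + δ) * u x) Ω := h1.const_mul _
  have hcon : IntegrableOn (fun _ : En n => (1 + δ) * M) Ω := integrableOn_const hΩ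
  have h4 := setIntegral_mono_on (hint.sub hcon) h2 hΩm hpt
  simp only [Pi.sub_apply] at h4
  rw [integral_sub hint hcon, integral_const_mul, setIntegral_const, smul_eq_mul, ← h3] at h4
  rw [le_div_iff₀ hδ]
  linarith

/-- Testing the equation with the solution itself bounds its energy by its supremum. -/
lemma energy_le_of_isWeakSolution {n : ℕ} {c s L K : ℝ} {Ω : Set (En n)}
    (hΩm : MeasurableSet Ω) {g : ℝ → ℝ} (hg0 : ∀ t ∈ Ici (0:ℝ), 0 ≤ g t)
    {u : En n → ℝ} (hu : ∀ x, 0 ≤ u x) (hL : 0 ≤ L) (huL : ∀ x ∈ Ω, u x ≤ L)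
    (hw : IsWeakSolution c s Ω g u) (hgi : IntegrableOn (fun x => g (u x)) Ω)
    (hK : ∫ x in Ω, g (u x) ≤ K) :
    (c / 2) * (∫ p in crossSet Ω, gagSq s u p) + ∫ x in Ω, (u x) ^ 2 ≤ L * K := by
  obtain ⟨-, -, h2, h3⟩ := hw.2.2 _ hw.2.1
  rw [gagBil_self] at h3
  simp only [sq]
  rw [h3]
  have h4 : ∫ x in Ω, g (u x) * u x ≤ ∫ x in Ω, L * g (u x) :=
    setIntegral_mono_on h2 (hgi.const_mul L) hΩm fun x hx => by
      rw [mul_comm]; exact mul_le_mul_of_nonneg_right (huL x hx) (hg0 _ (hu x))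
  rw [integral_const_mul] at h4
  exact h4.trans (mul_le_mul_of_nonneg_left hK hL)

/-- Uniform bounds for solutions whose values are given by a monotone profile obeying the energy
estimate `hosc` and the mass estimate `hmass`. -/
lemma exists_uniform_bound {n : ℕ} {s c T M δ κ V : ℝ} (hs : 1 / 2 < s) (hc : 0 < c)
    (hT : 0 < T) (hM : 0 < M) (hδ : 0 < δ) (hκ : 0 < κ) (hV : 0 < V)
    {Ω : Set (En n)} (hΩm : MeasurableSet Ω) (hΩ : volume Ω ≠ ⊤) :
    ∃ Kinf > (0:ℝ), ∃ K₂ > (0:ℝ), ∀ g : ℝ → ℝ, (∀ t ∈ Ici (0:ℝ), 0 ≤ g t) →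
      (∀ t ≥ M, (1 + δ) * t ≤ g t) → ∀ (u : En n → ℝ) (ψ : ℝ → ℝ), (∀ x, 0 ≤ u x) →
      IsWeakSolution c s Ω g u → AntitoneOn ψ (Icc 0 (4 * T)) →
      (∀ x ∈ Ω, ∃ τ ∈ Ioc 0 (4 * T), u x = ψ τ) →
      (∀ t, 0 < t → t ≤ T →
        (ψ t - ψ (2 * t)) ^ 2 * (κ * t ^ (1 - 2 * s)) ≤ ∫ z in crossSet Ω, gagSq s u z) →
      (IntegrableOn u Ω → ψ T * V ≤ ∫ x in Ω, u x) →
      (∀ x ∈ Ω, |u x| ≤ Kinf) ∧ HsNorm c s Ω u ≤ K₂ := by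
  set K := (1 + δ) * M * volume.real Ω / δ with hK
  have hK0 : 0 ≤ K := by positivity
  set σ := s - 1 / 2 with hσ
  have hσ0 : 0 < σ := by rw [hσ]; linarith
  have h2 : 0 < (2 : ℝ) ^ σ - 1 := sub_pos.mpr (Real.one_lt_rpow (by norm_num) hσ0)
  set C := T ^ σ / (2 ^ σ - 1) with hC
  have hC0 : 0 ≤ C := by positivity
  set B := 2 * (K / V) + C ^ 2 * (2 * K / c) / κ with hB
  have hB0 : 0 ≤ B := by positivity
  refine ⟨B + 1, by positivity, 2 * (B * K) ^ (1 / 2 : ℝ) + 1, by positivity, ?_⟩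
  intro g hg0 hg u ψ hu hw hψ hval hosc hmass
  obtain ⟨hui, hgi, hgu, huK⟩ := integral_le_of_isWeakSolution hΩm hΩ hM.le hδ hg0 hg hu hw
  set E := ∫ z in crossSet Ω, gagSq s u z with hE
  have hE0 : 0 ≤ E := integral_nonneg (gagSq_nonneg s u)
  have hψT : ψ T ≤ K / V := by
    rw [le_div_iff₀ hV]; exact (hmass hui).trans huK
  have hinc : ∀ t, 0 < t → t ≤ T → ψ t - ψ (2 * t) ≤ √(E / κ) * t ^ σ := by
    intro t ht htT
    have h := hosc t ht htT
    refine le_of_sq_le_sq ?_ (by positivity)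
    have e : (t ^ σ) ^ 2 * t ^ (1 - 2 * s) = 1 := by
      rw [← Real.rpow_natCast, ← Real.rpow_mul ht.le, ← Real.rpow_add ht, hσ]
      norm_num
      ring_nf
      simp
    have h5 : 0 < t ^ (1 - 2 * s) := Real.rpow_pos_of_pos ht _
    rw [mul_pow, Real.sq_sqrt (by positivity)]
    refine le_of_mul_le_mul_right ?_ (mul_pos hκ h5)
    calc _ ≤ E := h
      _ = E / κ * κ * ((t ^ σ) ^ 2 * t ^ (1 - 2 * s)) := by rw [e]; field_simp
      _ = _ := by ring
  set L := K / V + √(E / κ) * C with hL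
  have hL0 : 0 ≤ L := by positivity
  have huL : ∀ x ∈ Ω, u x ≤ L := by
    intro x hx
    obtain ⟨τ, hτ, hxτ⟩ := hval x hx
    have h := le_of_dyadic_increment hT hσ0 (Real.sqrt_nonneg _) hψ hinc hτ
    have e : √(E / κ) / (2 ^ σ - 1) * T ^ σ = √(E / κ) * C := by rw [hC]; ring
    rw [hxτ]
    linarith
  have hen := energy_le_of_isWeakSolution hΩm hg0 hu hL0 huL hw hgi (hgu.le.trans huK)
  rw [← hE] at hen
  have hsq0 : 0 ≤ ∫ x in Ω, (u x) ^ 2 := integral_nonneg fun x => sq_nonneg _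
  have hEL : E ≤ 2 * K / c * L := by
    rw [div_mul_eq_mul_div, le_div_iff₀ hc]
    linarith
  have hLB : L ≤ B := by
    have h6 : (√(E / κ) * C) ^ 2 ≤ C ^ 2 * (2 * K / c) / κ * L := by
      rw [mul_pow, Real.sq_sqrt (by positivity)]
      calc E / κ * C ^ 2 ≤ (2 * K / c * L) / κ * C ^ 2 := by gcongr
        _ = _ := by ring
    have h7 : 0 ≤ C ^ 2 * (2 * K / c) / κ := by positivity
    have h8 : √(E / κ) * C ≤ (C ^ 2 * (2 * K / c) / κ + L) / 2 := by
      refine le_of_sq_le_sq (h6.trans ?_) (by positivity)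
      nlinarith [sq_nonneg (C ^ 2 * (2 * K / c) / κ - L)]
    linarith
  have hLK : L * K ≤ B * K := by gcongr
  refine ⟨fun x hx => ?_, ?_⟩
  · rw [abs_of_nonneg (hu x)]
    linarith [huL x hx]
  · have hcE : 0 ≤ c / 2 * E := by positivity
    have h9 : (∫ x in Ω, (u x) ^ 2) ^ (1 / 2 : ℝ) ≤ (B * K) ^ (1 / 2 : ℝ) :=
      Real.rpow_le_rpow hsq0 (by linarith) (by norm_num)
    have h10 : (c / 2 * E) ^ (1 / 2 : ℝ) ≤ (B * K) ^ (1 / 2 : ℝ) :=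
      Real.rpow_le_rpow hcE (by linarith) (by norm_num)
    unfold HsNorm seminormSq
    rw [← hE]
    linarith

lemma le_setIntegral_of_le_on_openShell {n : ℕ} (hn : 1 ≤ n) {p t ρ a : ℝ} (hp : 0 ≤ p)
    (ht : 0 < t) (hρ : 0 ≤ ρ) (hρp : ρ ≤ p + t) (ha : 0 ≤ a) {Ω : Set (En n)}
    (hsub : openShell n p (p + t) ⊆ Ω) {u : En n → ℝ} (hu : ∀ x, 0 ≤ u x)
    (hui : IntegrableOn u Ω) (hle : ∀ x ∈ openShell n p (p + t), a ≤ u x) :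
    a * (unitBallVolume n * (t * ρ ^ (n - 1))) ≤ ∫ x in Ω, u x := by
  have hω := unitBallVolume_pos n
  calc a * (unitBallVolume n * (t * ρ ^ (n - 1)))
      ≤ a * (unitBallVolume n * (t * (p + t) ^ (n - 1))) := by gcongr
    _ ≤ a * volume.real (openShell n p (p + t)) := by
        gcongr; exact le_volume_real_openShell hn hp ht
    _ = ∫ _x in openShell n p (p + t), a := by rw [setIntegral_const, smul_eq_mul, mul_comm]
    _ ≤ ∫ x in openShell n p (p + t), u x :=
        setIntegral_mono_on (integrableOn_const (volume_openShell_ne_top _ _ _))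
          (hui.mono_set hsub) (isOpen_openShell _ _ _).measurableSet hle
    _ ≤ ∫ x in Ω, u x :=
        setIntegral_mono_set hui (Eventually.of_forall hu) hsub.eventuallyLE

lemma isOpen_annR (n : ℕ) (R₀ R : ℝ) : IsOpen (annR n R₀ R) := by
  unfold annR
  split_ifs
  · exact Metric.isOpen_ball
  · exact isOpen_openShell n R₀ R

lemma openShell_subset_annR {n : ℕ} {R₀ R a b : ℝ} (ha : R₀ ≤ a) (hb : b ≤ R) :
    openShell n a b ⊆ annR n R₀ R := by
  intro x hx
  unfold annR
  split_ifs
  · simpa using hx.2.trans_le hb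
  · exact ⟨ha.trans_lt hx.1, hx.2.trans_le hb⟩

lemma annR_subset_ball (n : ℕ) (R₀ R : ℝ) : annR n R₀ R ⊆ Metric.ball 0 R := by
  unfold annR
  split_ifs
  · exact subset_rfl
  · exact openShell_subset_ball n R₀ R

lemma norm_mem_Ico_of_mem_annR {n : ℕ} {R₀ R : ℝ} {x : En n} (hx : x ∈ annR n R₀ R) :
    ‖x‖ ∈ Ico R₀ R := by
  refine ⟨?_, by simpa using annR_subset_ball n R₀ R hx⟩
  unfold annR at hx
  split_ifs at hx with h
  · rw [h]; exact norm_nonneg x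
  · exact hx.1.le

/-- uniform L∞ and `H^s_{Ω,0}` a priori bounds for solutions in the cone with
nonlinearity in `𝔉_{M,δ}`. -/
theorem statement9 {n : ℕ} (hn : 1 ≤ n) {s c R₀ R M δ : ℝ}
    (hs : s ∈ Ioo (1/2 : ℝ) 1) (hc : 0 < c) (hR₀ : 0 ≤ R₀) (hR : R₀ < R)
    (hM : 0 < M) (hδ : 0 < δ)
    (Ω : Set (En n)) (hΩ : Ω = annR n R₀ R) :
    ∃ Kinf > (0:ℝ), ∃ K₂ > (0:ℝ), ∀ g : ℝ → ℝ,
      ContinuousOn g (Ici 0) → (∀ t ∈ Ici (0:ℝ), 0 ≤ g t) →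
      (∀ t ≥ M, (1 + δ) * t ≤ g t) →
      ∀ u : En n → ℝ,
        (InConePlus s R₀ R Ω u ∨ (0 < R₀ ∧ InConeMinus s R₀ R Ω u)) →
        IsWeakSolution c s Ω g u →
        (∀ᵐ x ∂(volume.restrict Ω), |u x| ≤ Kinf) ∧ HsNorm c s Ω u ≤ K₂ := by
  have hΩm : MeasurableSet Ω := hΩ ▸ (isOpen_annR n R₀ R).measurableSet
  have hΩf : volume Ω ≠ ⊤ :=
    hΩ ▸ measure_ne_top_of_subset (annR_subset_ball n R₀ R) measure_ball_lt_top.ne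
  have hs0 : 0 ≤ s := by linarith [hs.1]
  have hRpos : 0 < R := hR₀.trans_lt hR
  have hω := unitBallVolume_pos n
  obtain ⟨T, hT⟩ : ∃ T, R = R₀ + 4 * T := ⟨(R - R₀) / 4, by ring⟩
  have hT0 : 0 < T := by linarith
  have hbound : ∀ ρ : ℝ, 0 < ρ → _ := fun ρ hρ =>
    exists_uniform_bound (n := n) (s := s) (c := c) (T := T) (M := M) (δ := δ)
      (κ := (unitBallVolume n) ^ 2 * ρ ^ (n - 1) / 4 ^ ((n : ℝ) + 2 * s))
      (V := unitBallVolume n * (T * ρ ^ (n - 1))) hs.1 hc hT0 hM hδ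
      (by positivity) (by positivity) hΩm hΩf
  have hplus : ∃ Kinf > (0:ℝ), ∃ K₂ > (0:ℝ), ∀ g : ℝ → ℝ, (∀ t ∈ Ici (0:ℝ), 0 ≤ g t) →
      (∀ t ≥ M, (1 + δ) * t ≤ g t) → ∀ u : En n → ℝ, InConePlus s R₀ R Ω u →
      IsWeakSolution c s Ω g u → (∀ x ∈ Ω, |u x| ≤ Kinf) ∧ HsNorm c s Ω u ≤ K₂ := by
    obtain ⟨K, hK, K', hK', h⟩ := hbound R hRpos
    refine ⟨K, hK, K', hK', fun g hg0 hg u ⟨hmem, hu, φ, hφ, hmono⟩ hw =>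
      h g hg0 hg u (fun τ => φ (R - τ)) hu hw ?_ ?_ ?_ ?_⟩
    · intro a ha b hb hab
      exact hmono ⟨by linarith [hb.2], by linarith [hb.1]⟩ ⟨by linarith [ha.2], by linarith [ha.1]⟩
        (by linarith)
    · intro x hx
      have hx' := norm_mem_Ico_of_mem_annR (hΩ ▸ hx)
      exact ⟨R - ‖x‖, ⟨by linarith [hx'.2], by linarith [hx'.1]⟩, by rw [hφ x]; simp⟩
    · intro t ht htT
      have hd : φ (R - 2 * t) ≤ φ (R - t) :=
        hmono ⟨by linarith, by linarith⟩ ⟨by linarith, by linarith⟩ (by linarith)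
      refine sq_mul_le_integral_gagSq (p := R - t) (q := R - 4 * t) hn hs0 (by linarith)
        (by linarith) ht hRpos.le (by linarith) (sub_nonneg.mpr hd) ?_ ?_ hmem.2.2 ?_
      · intro r hr
        rw [abs_le]
        constructor <;> linarith [hr.1, hr.2]
      · rw [hΩ]; exact openShell_subset_annR (by linarith) (by linarith)
      · intro x ⟨hx1, hx2⟩ y ⟨hy1, hy2⟩
        rw [hφ x, hφ y]
        have h1 : φ (R - t) ≤ φ ‖x‖ :=
          hmono ⟨by linarith, by linarith⟩ ⟨by linarith, by linarith⟩ hx1.le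
        have h2 : φ ‖y‖ ≤ φ (R - 2 * t) :=
          hmono ⟨by linarith, by linarith⟩ ⟨by linarith, by linarith⟩ (by linarith)
        exact le_trans (by linarith) (le_abs_self _)
    · intro hui
      have hφ0 : ∀ x : En n, 0 ≤ φ ‖x‖ := fun x => hφ x ▸ hu x
      have ha : 0 ≤ φ (R - T) := by
        have : Nonempty (Fin n) := ⟨⟨0, hn⟩⟩
        obtain ⟨x, hx⟩ := exists_norm_eq (En n) (show 0 ≤ R - T by linarith)
        exact hx ▸ hφ0 x
      refine le_setIntegral_of_le_on_openShell (p := R - T) hn (by linarith) hT0 hRpos.le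
        (by linarith) ha ?_ hu hui ?_
      · rw [hΩ]; exact openShell_subset_annR (by linarith) (by linarith)
      · intro x ⟨hx1, hx2⟩
        rw [hφ x]
        exact hmono ⟨by linarith, by linarith⟩ ⟨by linarith, by linarith⟩ hx1.le
  have hminus : ∃ Kinf > (0:ℝ), ∃ K₂ > (0:ℝ), ∀ g : ℝ → ℝ, (∀ t ∈ Ici (0:ℝ), 0 ≤ g t) →
      (∀ t ≥ M, (1 + δ) * t ≤ g t) → ∀ u : En n → ℝ, 0 < R₀ ∧ InConeMinus s R₀ R Ω u →
      IsWeakSolution c s Ω g u → (∀ x ∈ Ω, |u x| ≤ Kinf) ∧ HsNorm c s Ω u ≤ K₂ := by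
    rcases hR₀.eq_or_lt with h0 | h0
    · exact ⟨1, one_pos, 1, one_pos, fun _ _ _ _ h => absurd h.1 (by simp [← h0])⟩
    obtain ⟨K, hK, K', hK', h⟩ := hbound R₀ h0
    refine ⟨K, hK, K', hK', fun g hg0 hg u ⟨_, hmem, hu, φ, hφ, hanti⟩ hw =>
      h g hg0 hg u (fun τ => φ (R₀ + τ)) hu hw ?_ ?_ ?_ ?_⟩
    · intro a ha b hb hab
      exact hanti ⟨by linarith [ha.1], by linarith [ha.2]⟩ ⟨by linarith [hb.1], by linarith [hb.2]⟩
        (by linarith)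
    · intro x hx
      rw [hΩ, annR, if_neg h0.ne'] at hx
      exact ⟨‖x‖ - R₀, ⟨by linarith [hx.1], by linarith [hx.2]⟩, by rw [hφ x]; simp⟩
    · intro t ht htT
      have hd : φ (R₀ + 2 * t) ≤ φ (R₀ + t) :=
        hanti ⟨by linarith, by linarith⟩ ⟨by linarith, by linarith⟩ (by linarith)
      refine sq_mul_le_integral_gagSq (p := R₀) (q := R₀ + 2 * t) hn hs0 hR₀
        (by linarith) ht hR₀ (by linarith) (sub_nonneg.mpr hd) ?_ ?_ hmem.2.2 ?_
      · intro r hr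
        rw [abs_le]
        constructor <;> linarith [hr.1, hr.2]
      · rw [hΩ]; exact openShell_subset_annR le_rfl (by linarith)
      · intro x ⟨hx1, hx2⟩ y ⟨hy1, hy2⟩
        rw [hφ x, hφ y]
        have h1 : φ (R₀ + t) ≤ φ ‖x‖ :=
          hanti ⟨by linarith, by linarith⟩ ⟨by linarith, by linarith⟩ hx2.le
        have h2 : φ ‖y‖ ≤ φ (R₀ + 2 * t) :=
          hanti ⟨by linarith, by linarith⟩ ⟨by linarith, by linarith⟩ hy1.le
        exact le_trans (by linarith) (le_abs_self _)
    · intro hui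
      have hφ0 : ∀ x : En n, 0 ≤ φ ‖x‖ := fun x => hφ x ▸ hu x
      have ha : 0 ≤ φ (R₀ + T) := by
        have : Nonempty (Fin n) := ⟨⟨0, hn⟩⟩
        obtain ⟨x, hx⟩ := exists_norm_eq (En n) (show 0 ≤ R₀ + T by linarith)
        exact hx ▸ hφ0 x
      refine le_setIntegral_of_le_on_openShell (p := R₀) hn hR₀ hT0 hR₀
        (by linarith) ha ?_ hu hui ?_
      · rw [hΩ]; exact openShell_subset_annR le_rfl (by linarith)
      · intro x ⟨hx1, hx2⟩
        rw [hφ x]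
        exact hanti ⟨by linarith, by linarith⟩ ⟨by linarith, by linarith⟩ hx2.le
  obtain ⟨K, hK, K₂, hK₂, hp⟩ := hplus
  obtain ⟨K', hK', K₂', hK₂', hm⟩ := hminus
  refine ⟨max K K', lt_max_of_lt_left hK, max K₂ K₂', lt_max_of_lt_left hK₂,
    fun g _ hg0 hg u hcone hw => ?_⟩
  rcases hcone with h | h
  · obtain ⟨h1, h2⟩ := hp g hg0 hg u h hw
    exact ⟨ae_restrict_of_forall_mem hΩm fun x hx => (h1 x hx).trans (le_max_left _ _),
      h2.trans (le_max_left _ _)⟩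
  · obtain ⟨h1, h2⟩ := hm g hg0 hg u h hw
    exact ⟨ae_restrict_of_forall_mem hΩm fun x hx => (h1 x hx).trans (le_max_right _ _),
      h2.trans (le_max_right _ _)⟩

end
end

section
/- Let n ≥ 1, s ∈ (0,1), and let Ω ⊆ ℝⁿ be a bounded measurable set of positive Lebesgue measure. Let u : ℝⁿ → ℝ be measurable and essentially bounded on Ω. Suppose that for every x ∈ ℝⁿ with dist(x,Ω) > 0 the function y ↦ (u(x)−u(y))/|x−y|^{n+2s} is integrable on Ω and ∫_Ω (u(x)−u(y))/|x−y|^{n+2s} dy = 0. Then |u(x)| ≤ ess sup_Ω |u| for every x ∈ ℝⁿ with dist(x,Ω) > 0. -/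
open MeasureTheory Filter Set

noncomputable section

/-- An integrable function with zero integral against a nonzero measure is not almost everywhere
positive. -/
lemma not_ae_pos_of_integral_eq_zero {α : Type*} [MeasurableSpace α] {μ : Measure α}
    {f : α → ℝ} (hμ : μ ≠ 0) (hf : Integrable f μ) (hzero : ∫ y, f y ∂μ = 0) :
    ¬ ∀ᵐ y ∂μ, 0 < f y := by
  intro hpos
  have hae := (integral_eq_zero_iff_of_nonneg_ae (hpos.mono fun _ h => h.le) hf).1 hzero
  have hfalse : ∀ᵐ _ ∂μ, False := by
    filter_upwards [hpos, hae] with y h₁ h₂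
    exact h₁.ne' h₂
  exact hμ (ae_eq_bot.1 (eventually_false_iff_eq_bot.1 hfalse))

/-- a function whose nonlocal normal derivative vanishes outside `Ω` is
bounded outside by its essential sup on `Ω`. -/
theorem statement10 {n : ℕ} (hn : 1 ≤ n) {s : ℝ} (hs : s ∈ Ioo (0:ℝ) 1)
    {Ω : Set (En n)} (hmeasΩ : MeasurableSet Ω) (hbdd : Bornology.IsBounded Ω)
    (hpos : 0 < volume Ω)
    (u : En n → ℝ) (hmeas : Measurable u)
    (hbddu : ∃ C : ℝ, ∀ᵐ x ∂(volume.restrict Ω), |u x| ≤ C)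
    (hzero : ∀ x : En n, 0 < Metric.infDist x Ω →
      IntegrableOn (fun y => (u x - u y) / dist x y ^ ((n:ℝ) + 2 * s)) Ω ∧
      (∫ y in Ω, (u x - u y) / dist x y ^ ((n:ℝ) + 2 * s)) = 0) :
    ∀ x : En n, 0 < Metric.infDist x Ω →
      |u x| ≤ essSup (fun y => |u y|) (volume.restrict Ω) := by
  intro x hx
  obtain ⟨hint, hint0⟩ := hzero x hx
  have hμ : volume.restrict Ω ≠ 0 := by
    simpa [Measure.restrict_eq_zero] using hpos.ne'
  have hess : ∀ᵐ y ∂(volume.restrict Ω),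
      |u y| ≤ essSup (fun y => |u y|) (volume.restrict Ω) := by
    obtain ⟨C, hC⟩ := hbddu
    exact ae_le_essSup ⟨C, hC⟩
  have hkernel : ∀ y ∈ Ω, 0 < dist x y ^ ((n:ℝ) + 2 * s) := fun y hy =>
    Real.rpow_pos_of_pos (hx.trans_le (Metric.infDist_le_dist_of_mem hy)) _
  by_contra! hlt
  rcases lt_abs.1 hlt with hux | hux
  · refine not_ae_pos_of_integral_eq_zero hμ hint hint0 ?_
    filter_upwards [hess, ae_restrict_mem hmeasΩ] with y hy hyΩ
    exact div_pos (by linarith [le_abs_self (u y)]) (hkernel y hyΩ)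
  · refine not_ae_pos_of_integral_eq_zero hμ hint.neg ?_ ?_
    · simpa [integral_neg] using hint0
    · filter_upwards [hess, ae_restrict_mem hmeasΩ] with y hy hyΩ
      exact neg_pos.2 (div_neg_of_neg_of_pos (by linarith [neg_abs_le (u y)]) (hkernel y hyΩ))

end
end
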